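/- arXiv:2203.01840 — 2 statements merged into one kernel-verified Lean document; each statement's English description precedes it below -/
import Mathlib

section
/- Let k be a field and d ≥ 1 an integer such that d! is invertible in k. Let p ∈ k[y] be a polynomial whose constant coefficient is 0, and suppose that y^{2d} divides p^d − y^d in k[y]. Then the coefficient of y in p has d-th power equal to 1, and the coefficients of y², y³, …, y^d in p are all zero. -/
open Polynomial

/-- If `d` is nonzero in `k` and `X ^ n` divides `q ^ d - 1` with `n ≠ 0`, then `q` is congruent
modulo `X ^ n` to its constant coefficient. -/
theorem X_pow_dvd_sub_C_of_dvd_pow_sub_one {k : Type*} [Field k] {d n : ℕ} (hd : (d : k) ≠ 0)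
    {q : k[X]} (hq : q.coeff 0 ^ d = 1) (h : X ^ n ∣ q ^ d - 1) :
    X ^ n ∣ q - C (q.coeff 0) := by
  have hd0 : d ≠ 0 := by
    rintro rfl
    simp at hd
  have ha : q.coeff 0 ≠ 0 := by
    intro ha
    simp [ha, hd0] at hq
  refine prime_X.pow_dvd_of_dvd_mul_left n
    (a := ∑ i ∈ Finset.range d, q ^ i * C (q.coeff 0) ^ (d - 1 - i)) ?_ ?_
  · rw [X_dvd_iff, coeff_zero_eq_eval_zero, eval_finsetSum]
    simp [← coeff_zero_eq_eval_zero, geom_sum₂_self, hd, ha]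
  · rwa [geom_sum₂_mul, ← C_pow, hq, C_1]

/-- Let `k` be a field in which `d!` is invertible, and let `p ∈ k[y]` have zero constant
term.  If `y^(2d)` divides `p^d - y^d`, then the coefficient of `y` in `p` is a `d`-th
root of unity and the coefficients of `y^2, …, y^d` in `p` all vanish. -/
theorem coefficient_computation (k : Type*) [Field k] (d : ℕ) (hd : 1 ≤ d)
    (hfact : (Nat.factorial d : k) ≠ 0) (p : Polynomial k) (h0 : p.coeff 0 = 0)
    (hdvd : (X : Polynomial k) ^ (2 * d) ∣ p ^ d - X ^ d) :
    (p.coeff 1) ^ d = 1 ∧ ∀ i : ℕ, 2 ≤ i → i ≤ d → p.coeff i = 0 := by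
  obtain ⟨q, rfl⟩ := X_dvd_iff.mpr h0
  have hdk : (d : k) ≠ 0 := by
    intro h
    obtain ⟨m, hm⟩ := Nat.dvd_factorial hd le_rfl
    simp [hm, h] at hfact
  have hq : X ^ d ∣ q ^ d - 1 := by
    have hX : (X : k[X]) ^ d ≠ 0 := pow_ne_zero d X_ne_zero
    rwa [mul_pow, two_mul, pow_add, ← mul_sub_one, mul_dvd_mul_iff_left hX] at hdvd
  have hroot : q.coeff 0 ^ d = 1 := by
    have h := X_dvd_iff.mp ((dvd_pow_self X (by lia)).trans hq)
    simpa [coeff_zero_eq_eval_zero, sub_eq_zero] using h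
  refine ⟨by rwa [coeff_X_mul q 0], fun i hi hid => ?_⟩
  obtain ⟨j, rfl⟩ : ∃ j, i = j + 1 := ⟨i - 1, by lia⟩
  have h := X_pow_dvd_iff.mp (X_pow_dvd_sub_C_of_dvd_pow_sub_one hdk hroot hq) j (by lia)
  rw [coeff_sub, coeff_C_of_ne_zero (by lia), sub_zero] at h
  rwa [coeff_X_mul]
end

section
/- Let R be a commutative ring and let G := GL₄(R) × GL₅(R). (i) For every (M, N) ∈ G there is a unique unit λ ∈ Rˣ such that (det(λ²·M))² = det(λ³·N), namely λ = det(N)·det(M)^{−2}. (ii) Let Z ≤ G be the image of the group homomorphism Rˣ → G, λ ↦ (λ²·I₄, λ³·I₅) (a central, hence normal, subgroup), and let K ≤ G be the subgroup of pairs (M, N) with (det M)² = det N. Then the composite of the inclusion K ↪ G with the quotient map G → G/Z is an isomorphism of groups K ≅ G/Z. -/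
open Matrix

/-- The homomorphism `Rˣ → GL_n(R)`, `λ ↦ λ·Iₙ`. -/
noncomputable def scalarUnitsHom (n : ℕ) (R : Type*) [CommRing R] :
    Rˣ →* GL (Fin n) R :=
  Units.map (algebraMap R (Matrix (Fin n) (Fin n) R)).toMonoidHom

/-- The homomorphism `Rˣ → GL₄(R) × GL₅(R)`, `λ ↦ (λ²·I₄, λ³·I₅)`. -/
noncomputable def zHom6 (R : Type*) [CommRing R] :
    Rˣ →* GL (Fin 4) R × GL (Fin 5) R :=
  MonoidHom.prod ((scalarUnitsHom 4 R).comp (powMonoidHom 2))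
    ((scalarUnitsHom 5 R).comp (powMonoidHom 3))

/-- The subgroup `Z ≤ GL₄(R) × GL₅(R)`, the image of `λ ↦ (λ²·I₄, λ³·I₅)`. -/
noncomputable def Zsub6 (R : Type*) [CommRing R] :
    Subgroup (GL (Fin 4) R × GL (Fin 5) R) :=
  (zHom6 R).range

/-- The subgroup `K ≤ GL₄(R) × GL₅(R)` of pairs `(M, N)` with `(det M)² = det N`. -/
def Ksub6 (R : Type*) [CommRing R] : Subgroup (GL (Fin 4) R × GL (Fin 5) R) where
  carrier :=
    {p | (Matrix.GeneralLinearGroup.det p.1) ^ 2 = Matrix.GeneralLinearGroup.det p.2}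
  one_mem' := by simp
  mul_mem' := by
    intro p q hp hq
    simp only [Set.mem_setOf_eq, Prod.fst_mul, Prod.snd_mul, _root_.map_mul, mul_pow] at *
    rw [hp, hq]
  inv_mem' := by
    intro p hp
    simp only [Set.mem_setOf_eq, Prod.fst_inv, Prod.snd_inv, _root_.map_inv, inv_pow] at *
    rw [hp]

instance Zsub6.normal (R : Type*) [CommRing R] : (Zsub6 R).Normal := by
  constructor
  rintro x ⟨l, rfl⟩ g
  refine ⟨l, ?_⟩
  have h1 : g.1 * (zHom6 R l).1 = (zHom6 R l).1 * g.1 := by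
    apply Units.ext
    simp only [Units.val_mul, zHom6, scalarUnitsHom, MonoidHom.prod_apply,
      MonoidHom.comp_apply, RingHom.toMonoidHom_eq_coe, Units.coe_map, MonoidHom.coe_coe]
    exact (Algebra.commutes _ _).symm
  have h2 : g.2 * (zHom6 R l).2 = (zHom6 R l).2 * g.2 := by
    apply Units.ext
    simp only [Units.val_mul, zHom6, scalarUnitsHom, MonoidHom.prod_apply,
      MonoidHom.comp_apply, RingHom.toMonoidHom_eq_coe, Units.coe_map, MonoidHom.coe_coe]
    exact (Algebra.commutes _ _).symm
  have hc : g * zHom6 R l = zHom6 R l * g := Prod.ext h1 h2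
  rw [hc, mul_assoc, mul_inv_cancel, mul_one]

theorem det_scalarUnitsHom (n : ℕ) (R : Type*) [CommRing R] (u : Rˣ) :
    Matrix.GeneralLinearGroup.det (scalarUnitsHom n R u) = u ^ n := by
  ext
  simp [scalarUnitsHom, Matrix.algebraMap_eq_diagonal]

theorem scalarUnitsHom_mem_center (n : ℕ) (R : Type*) [CommRing R] (u : Rˣ) :
    scalarUnitsHom n R u ∈ Subgroup.center (GL (Fin n) R) := by
  rw [Subgroup.mem_center_iff]
  intro g
  ext1
  exact (Algebra.commutes (u : R) (g : Matrix (Fin n) (Fin n) R)).symm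

theorem zHom6_apply (R : Type*) [CommRing R] (l : Rˣ) :
    zHom6 R l = (scalarUnitsHom 4 R (l ^ 2), scalarUnitsHom 5 R (l ^ 3)) := by
  simp only [zHom6, MonoidHom.prod_apply, MonoidHom.comp_apply, powMonoidHom_apply]

theorem zHom6_mem_Zsub6 (R : Type*) [CommRing R] (l : Rˣ) : zHom6 R l ∈ Zsub6 R :=
  ⟨l, rfl⟩

theorem Zsub6_le_center (R : Type*) [CommRing R] :
    Zsub6 R ≤ Subgroup.center (GL (Fin 4) R × GL (Fin 5) R) := by
  rintro _ ⟨l, rfl⟩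
  rw [Subgroup.mem_center_iff]
  intro g
  rw [zHom6_apply]
  ext1
  · exact Subgroup.mem_center_iff.1 (scalarUnitsHom_mem_center 4 R (l ^ 2)) g.1
  · exact Subgroup.mem_center_iff.1 (scalarUnitsHom_mem_center 5 R (l ^ 3)) g.2

theorem pow_sixteen_mul_eq_pow_fifteen_mul_iff {G : Type*} [CommGroup G] (l a b : G) :
    l ^ 16 * a = l ^ 15 * b ↔ l = b * a⁻¹ := by
  rw [pow_succ, mul_assoc, mul_right_inj, eq_mul_inv_iff_mul_eq]

theorem zHom6_mul_mem_Ksub6_iff (R : Type*) [CommRing R] (l : Rˣ)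
    (p : GL (Fin 4) R × GL (Fin 5) R) :
    zHom6 R l * p ∈ Ksub6 R ↔
      l = Matrix.GeneralLinearGroup.det p.2 * (Matrix.GeneralLinearGroup.det p.1 ^ 2)⁻¹ := by
  rw [← pow_sixteen_mul_eq_pow_fifteen_mul_iff]
  change Matrix.GeneralLinearGroup.det (zHom6 R l * p).1 ^ 2 =
    Matrix.GeneralLinearGroup.det (zHom6 R l * p).2 ↔ _
  rw [zHom6_apply, Prod.fst_mul, Prod.snd_mul, map_mul, map_mul, det_scalarUnitsHom,
    det_scalarUnitsHom, mul_pow, ← pow_mul, ← pow_mul, ← pow_mul]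

/-- The degree-5 case of the lemma: for `(M, N) ∈ GL₄(R) × GL₅(R)` there is a unique unit
`λ` with `(det(λ²M))² = det(λ³N)`, namely `λ = det N · (det M)⁻²`; the subgroup `Z`
(image of `λ ↦ (λ²I₄, λ³I₅)`) is central, and the composite of the inclusion of
`K = {(M,N) : (det M)² = det N}` with the quotient map `G → G/Z` is an isomorphism. -/
theorem aut_as_sub_deg5 (R : Type*) [CommRing R] :
    (∀ (M : GL (Fin 4) R) (N : GL (Fin 5) R) (lam : Rˣ),
      (((lam : R) ^ 2 • (M : Matrix (Fin 4) (Fin 4) R)).det) ^ 2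
          = (((lam : R) ^ 3) • (N : Matrix (Fin 5) (Fin 5) R)).det
        ↔ lam = Matrix.GeneralLinearGroup.det N * (Matrix.GeneralLinearGroup.det M ^ 2)⁻¹)
    ∧ Zsub6 R ≤ Subgroup.center (GL (Fin 4) R × GL (Fin 5) R)
    ∧ Function.Bijective ((QuotientGroup.mk' (Zsub6 R)).comp (Ksub6 R).subtype) := by
  refine ⟨fun M N lam => ?_, Zsub6_le_center R, ?_, ?_⟩
  · rw [← pow_sixteen_mul_eq_pow_fifteen_mul_iff, Units.ext_iff, Matrix.det_smul,
      Matrix.det_smul, mul_pow, ← pow_mul, ← pow_mul, ← pow_mul]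
    simp
  · rw [injective_iff_map_eq_one]
    rintro ⟨_, hK⟩ h
    obtain ⟨l, rfl⟩ := (QuotientGroup.eq_one_iff _).1 h
    rw [← mul_one (zHom6 R l), zHom6_mul_mem_Ksub6_iff] at hK
    obtain rfl : l = 1 := by simpa using hK
    exact Subtype.ext (map_one _)
  · intro q
    obtain ⟨p, rfl⟩ := QuotientGroup.mk'_surjective _ q
    refine ⟨⟨_, (zHom6_mul_mem_Ksub6_iff R _ p).2 rfl⟩, ?_⟩
    change QuotientGroup.mk' (Zsub6 R) (zHom6 R _ * p) = _
    rw [map_mul, QuotientGroup.mk'_apply,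
      (QuotientGroup.eq_one_iff _).2 (zHom6_mem_Zsub6 R _), one_mul]
end
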